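/- Let n ≥ 2 and let Ω be a bounded (α, β)-John domain in ℝⁿ. If 0 < δ ≤ n and p > δ/n, then there exists a constant c depending only on n, p, and δ such that inf_{b ∈ ℝ} ∫_Ω |u(x) − b|^p dH^δ_∞ ≤ c β^p (β/α)^{2np} ∫_Ω |∇u(x)|^p dH^δ_∞ for all u ∈ C¹(Ω). -/

import Mathlib

open MeasureTheory Metric Set Bornology
open scoped ENNReal NNReal

/-- The `δ`-dimensional Hausdorff content of a set `E ⊆ ℝⁿ`, defined as the infimum of
`∑ᵢ rᵢ^δ` over all countable coverings of `E` by open balls `B(xᵢ, rᵢ)`. -/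
noncomputable def hContent (n : ℕ) (δ : ℝ) (E : Set (EuclideanSpace ℝ (Fin n))) : ℝ≥0∞ :=
  ⨅ (x : ℕ → EuclideanSpace ℝ (Fin n)) (r : ℕ → ℝ≥0)
    (_ : E ⊆ ⋃ i, Metric.ball (x i) (r i)), ∑' i, (r i : ℝ≥0∞) ^ δ

/-- The `δ`-dimensional Hausdorff measure of `E ⊆ ℝⁿ`, obtained from coverings by open balls of
radii at most `ρ`, in the limit `ρ → 0⁺` (equivalently: the supremum over `ρ > 0`, since the
infima increase as `ρ` decreases). -/
noncomputable def hMeasure (n : ℕ) (δ : ℝ) (E : Set (EuclideanSpace ℝ (Fin n))) : ℝ≥0∞ :=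
  ⨆ (ρ : ℝ≥0) (_ : 0 < ρ),
    ⨅ (x : ℕ → EuclideanSpace ℝ (Fin n)) (r : ℕ → ℝ≥0)
      (_ : E ⊆ ⋃ i, Metric.ball (x i) (r i)) (_ : ∀ i, r i ≤ ρ), ∑' i, (r i : ℝ≥0∞) ^ δ

/-- The Choquet integral `∫_Ω f dH^δ_∞ = ∫₀^∞ H^δ_∞({x ∈ Ω : f x > t}) dt` of a
(nonnegative) real-valued function with respect to the Hausdorff content. -/
noncomputable def choquet (n : ℕ) (δ : ℝ) (Ω : Set (EuclideanSpace ℝ (Fin n)))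
    (f : EuclideanSpace ℝ (Fin n) → ℝ) : ℝ≥0∞ :=
  ∫⁻ t in Set.Ioi (0 : ℝ), hContent n δ {x ∈ Ω | t < f x}

/-- The Choquet integral of an `[0,∞]`-valued function with respect to the Hausdorff content. -/
noncomputable def echoquet (n : ℕ) (δ : ℝ) (Ω : Set (EuclideanSpace ℝ (Fin n)))
    (f : EuclideanSpace ℝ (Fin n) → ℝ≥0∞) : ℝ≥0∞ :=
  ∫⁻ t in Set.Ioi (0 : ℝ), hContent n δ {x ∈ Ω | ENNReal.ofReal t < f x}

/-- The centered fractional Hardy–Littlewood maximal function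
`M_κ f (x) = sup_{r>0} r^{κ-n} ∫_{B(x,r)} |f|`. -/
noncomputable def fracMaximal (n : ℕ) (κ : ℝ) (f : EuclideanSpace ℝ (Fin n) → ℝ)
    (x : EuclideanSpace ℝ (Fin n)) : ℝ≥0∞ :=
  ⨆ (r : ℝ) (_ : 0 < r),
    ENNReal.ofReal (r ^ (κ - n)) * ∫⁻ y in Metric.ball x r, ENNReal.ofReal |f y|

/-- The Riesz potential of order `1`: `I₁ f (x) = ∫_{ℝⁿ} |f y| / |x-y|^{n-1} dy`. -/
noncomputable def rieszPot (n : ℕ) (f : EuclideanSpace ℝ (Fin n) → ℝ)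
    (x : EuclideanSpace ℝ (Fin n)) : ℝ≥0∞ :=
  ∫⁻ y, ENNReal.ofReal |f y| / edist x y ^ ((n : ℝ) - 1)

/-- `Ω` is an `(α, β)`-John domain with John center `x₀`: every `x ∈ Ω` can be joined to `x₀`
by a rectifiable curve `γ : [0, L] → Ω` parametrized by arclength (hence `1`-Lipschitz) with
`γ 0 = x`, `γ L = x₀`, `L ≤ β` and `dist (γ t, ∂Ω) ≥ (α/β) t`. -/
def IsJohnDomainWithCenter (n : ℕ) (α β : ℝ) (Ω : Set (EuclideanSpace ℝ (Fin n)))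
    (x₀ : EuclideanSpace ℝ (Fin n)) : Prop :=
  x₀ ∈ Ω ∧ ∀ x ∈ Ω, ∃ L : ℝ, 0 ≤ L ∧ L ≤ β ∧ ∃ γ : ℝ → EuclideanSpace ℝ (Fin n),
    γ 0 = x ∧ γ L = x₀ ∧ (∀ t ∈ Set.Icc 0 L, γ t ∈ Ω) ∧
    LipschitzOnWith 1 γ (Set.Icc 0 L) ∧
    ∀ t ∈ Set.Icc 0 L, α / β * t ≤ Metric.infDist (γ t) (frontier Ω)

/-- `Ω` is an `(α, β)`-John domain. -/
def IsJohnDomain (n : ℕ) (α β : ℝ) (Ω : Set (EuclideanSpace ℝ (Fin n))) : Prop :=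
  ∃ x₀, IsJohnDomainWithCenter n α β Ω x₀

theorem ball_infDist_frontier_subset {F : Type*} [NormedAddCommGroup F] [NormedSpace ℝ F]
    {Ω : Set F} (hΩ : IsOpen Ω) {x : F} (hx : x ∈ Ω) :
    ball x (infDist x (frontier Ω)) ⊆ Ω := by
  rcases (ball x (infDist x (frontier Ω))).eq_empty_or_nonempty with h | h
  · simp [h]
  have hpos : 0 < infDist x (frontier Ω) := nonempty_ball.1 h
  have hdisj : ∀ z ∈ ball x (infDist x (frontier Ω)), z ∉ frontier Ω := fun z hz hzf =>
    absurd (infDist_le_dist_of_mem (x := x) hzf) (not_le.2 (by rwa [dist_comm, ← mem_ball]))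
  refine (convex_ball _ _).isPreconnected.subset_left_of_subset_union hΩ
    isClosed_closure.isOpen_compl (disjoint_compl_right.mono_left subset_closure) ?_
    ⟨x, mem_ball_self hpos, hx⟩
  intro z hz
  by_cases hzc : z ∈ closure Ω
  · left
    by_contra hzΩ
    exact hdisj z hz ⟨hzc, by rwa [hΩ.interior_eq]⟩
  · exact Or.inr hzc

theorem enorm_sub_le_lintegral_fderiv_of_curve {F : Type*} [NormedAddCommGroup F]
    [NormedSpace ℝ F] {Ω : Set F} (hΩ : IsOpen Ω) {u : F → ℝ} (hu : ContDiffOn ℝ 1 u Ω)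
    {T : ℝ} (hT : 0 ≤ T) {K : ℝ≥0} {γ : ℝ → F} (hγ : LipschitzOnWith K γ (Icc 0 T))
    (hγΩ : ∀ t ∈ Icc 0 T, γ t ∈ Ω) :
    ‖u (γ T) - u (γ 0)‖ₑ ≤ K * ∫⁻ t in Ioc 0 T, ‖fderiv ℝ u (γ t)‖ₑ := by
  have hD : ContinuousOn (fderiv ℝ u) Ω := hu.continuousOn_fderiv_of_isOpen hΩ le_rfl
  have hcont : ContinuousOn (fun t => ‖fderiv ℝ u (γ t)‖) (Icc 0 T) :=
    (hD.comp hγ.continuousOn hγΩ).norm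
  set h : ℝ → ℝ := IccExtend hT ((Icc 0 T).domRestrict fun t => ‖fderiv ℝ u (γ t)‖) with h_def
  have hh : Continuous h := hcont.domRestrict.Icc_extend'
  have hheq : ∀ t ∈ Icc 0 T, h t = ‖fderiv ℝ u (γ t)‖ := fun t ht => by
    rw [h_def, IccExtend_of_mem _ _ ht]; rfl
  have hderiv : ∀ t : ℝ, HasDerivAt (fun t => ∫ s in (0 : ℝ)..t, K * h s) (K * h t) t :=
    fun t => ((continuous_const.mul hh).integral_hasStrictDerivAt 0 t).hasDerivAt
  have key := image_le_of_liminf_slope_right_le_deriv_boundary (a := 0) (b := T)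
    (f := fun t => ‖u (γ t) - u (γ 0)‖) (B := fun t => ∫ s in (0 : ℝ)..t, K * h s)
    (B' := fun t => K * h t)
    (((hu.continuousOn.comp hγ.continuousOn hγΩ).sub continuousOn_const).norm) (by simp)
    (fun t _ => (hderiv t).continuousAt.continuousWithinAt)
    (fun t _ => (hderiv t).hasDerivWithinAt) ?_ (right_mem_Icc.2 hT)
  · rw [← ofReal_norm]
    refine (ENNReal.ofReal_le_ofReal key).trans ?_
    rw [intervalIntegral.integral_of_le hT, ofReal_integral_eq_lintegral_ofReal,
      ← lintegral_const_mul']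
    · refine setLIntegral_mono_ae' measurableSet_Ioc (.of_forall fun t ht => ?_)
      rw [hheq t (Ioc_subset_Icc_self ht), ENNReal.ofReal_mul K.coe_nonneg, ofReal_norm]
      simp
    · simp
    · exact ((continuous_const.mul hh).intervalIntegrable 0 T).1
    · refine ae_restrict_of_forall_mem measurableSet_Ioc fun t ht => ?_
      simp only [Pi.zero_apply]
      rw [hheq t (Ioc_subset_Icc_self ht)]
      positivity
  · intro t ht r hr
    have htI : t ∈ Icc 0 T := Ico_subset_Icc_self ht
    simp only [hheq t htI] at hr
    obtain ⟨η, hη, hηr⟩ : ∃ η > 0, K * (‖fderiv ℝ u (γ t)‖ + η) < r := by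
      have : Filter.Tendsto (fun η : ℝ => K * (‖fderiv ℝ u (γ t)‖ + η)) (nhdsWithin 0 (Ioi 0))
          (nhds (K * (‖fderiv ℝ u (γ t)‖ + 0))) :=
        ((continuous_const.mul (continuous_const.add continuous_id)).tendsto 0).mono_left
          nhdsWithin_le_nhds
      rw [add_zero] at this
      obtain ⟨η, h1, h2⟩ := ((this.eventually_lt_const hr).and self_mem_nhdsWithin).exists
      exact ⟨η, h2, h1⟩
    have hdiff : HasFDerivAt u (fderiv ℝ u (γ t)) (γ t) :=
      ((hu.differentiableOn one_ne_zero).differentiableAt (hΩ.mem_nhds (hγΩ t htI))).hasFDerivAt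
    have hcw : Filter.Tendsto γ (nhdsWithin t (Ioi t)) (nhds (γ t)) := by
      refine (hγ.continuousOn t htI).mono_left ?_
      rw [← nhdsWithin_Ioc_eq_nhdsGT ht.2]
      exact nhdsWithin_mono _ fun s hs => ⟨ht.1.trans hs.1.le, hs.2⟩
    have hev := hcw.eventually (hdiff.isLittleO.bound hη)
    have hev2 : ∀ᶠ z in nhdsWithin t (Ioi t), z ∈ Ioc t T := Ioc_mem_nhdsGT ht.2
    refine (hev.and hev2).frequently.mono ?_
    rintro z ⟨hz1, hz2⟩
    have hzt : 0 < z - t := sub_pos.2 hz2.1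
    have hlip : ‖γ z - γ t‖ ≤ K * (z - t) := by
      have := hγ.dist_le_mul z ⟨ht.1.trans hz2.1.le, hz2.2⟩ t htI
      rwa [dist_eq_norm, Real.dist_eq, abs_of_pos hzt] at this
    have hmain : ‖u (γ z) - u (γ t)‖ ≤ (‖fderiv ℝ u (γ t)‖ + η) * ‖γ z - γ t‖ := by
      have h1 := (fderiv ℝ u (γ t)).le_opNorm (γ z - γ t)
      have h2 := norm_le_norm_add_norm_sub' (u (γ z) - u (γ t)) (fderiv ℝ u (γ t) (γ z - γ t))
      linarith
    have hmain2 : ‖u (γ z) - u (γ t)‖ ≤ K * (‖fderiv ℝ u (γ t)‖ + η) * (z - t) := by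
      refine hmain.trans ?_
      calc (‖fderiv ℝ u (γ t)‖ + η) * ‖γ z - γ t‖
          ≤ (‖fderiv ℝ u (γ t)‖ + η) * (K * (z - t)) := by gcongr
        _ = _ := by ring
    have h3 : ‖u (γ z) - u (γ 0)‖ - ‖u (γ t) - u (γ 0)‖ ≤ ‖u (γ z) - u (γ t)‖ := by
      have := norm_sub_norm_le (u (γ z) - u (γ 0)) (u (γ t) - u (γ 0))
      rwa [sub_sub_sub_cancel_right] at this
    rw [slope_def_field, div_lt_iff₀ hzt]
    calc _ ≤ K * (‖fderiv ℝ u (γ t)‖ + η) * (z - t) := h3.trans hmain2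
      _ < r * (z - t) := by gcongr

theorem ENNReal.rpow_tsum_le_tsum_rpow {ι : Type*} (f : ι → ℝ≥0∞) {q : ℝ} (hq : 0 < q)
    (hq1 : q ≤ 1) : (∑' i, f i) ^ q ≤ ∑' i, f i ^ q := by
  have hfin : ∀ s : Finset ι, (∑ i ∈ s, f i) ^ q ≤ ∑ i ∈ s, f i ^ q := by
    intro s
    classical
    induction s using Finset.induction_on with
    | empty => simp [hq]
    | insert a s ha ih =>
      rw [Finset.sum_insert ha, Finset.sum_insert ha]
      exact (ENNReal.rpow_add_le_add_rpow _ _ hq.le hq1).trans (by gcongr)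
  have ht : Filter.Tendsto (fun s : Finset ι => (∑ i ∈ s, f i) ^ q) Filter.atTop
      (nhds ((∑' i, f i) ^ q)) :=
    (ENNReal.continuous_rpow_const.tendsto _).comp ENNReal.summable.hasSum
  exact le_of_tendsto' ht fun s => (hfin s).trans (ENNReal.sum_le_tsum s)

theorem hContent_mono {n : ℕ} {δ : ℝ} {A B : Set (EuclideanSpace ℝ (Fin n))} (h : A ⊆ B) :
    hContent n δ A ≤ hContent n δ B :=
  iInf_mono fun _ => iInf_mono fun _ => iInf_mono' fun hB => ⟨h.trans hB, le_rfl⟩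

theorem hContent_le_tsum {n : ℕ} {δ : ℝ} (hδ : 0 < δ) {A : Set (EuclideanSpace ℝ (Fin n))}
    {ι : Type*} [Countable ι] (x : ι → EuclideanSpace ℝ (Fin n)) (r : ι → ℝ≥0)
    (h : A ⊆ ⋃ i, ball (x i) (r i)) : hContent n δ A ≤ ∑' i, (r i : ℝ≥0∞) ^ δ := by
  classical
  obtain ⟨e, he⟩ := Countable.exists_injective_nat ι
  refine (iInf₂_le (Function.extend e x 0) (Function.extend e r 0)).trans
    ((iInf_le _ ?_).trans ?_)
  · refine h.trans (iUnion_subset fun i => ?_)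
    refine subset_iUnion_of_subset (e i) ?_
    rw [he.extend_apply, he.extend_apply]
  · rw [← tsum_extend_zero he]
    refine ENNReal.tsum_le_tsum fun k => ?_
    by_cases hk : ∃ i, e i = k
    · obtain ⟨i, rfl⟩ := hk
      rw [he.extend_apply, he.extend_apply]
    · rw [Function.extend_apply' _ _ _ hk]
      simp [hδ]

theorem hContent_le_rpow {n : ℕ} {δ : ℝ} (hδ : 0 < δ) {A : Set (EuclideanSpace ℝ (Fin n))}
    {x₀ : EuclideanSpace ℝ (Fin n)} {R : ℝ≥0} (hA : A ⊆ ball x₀ R) :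
    hContent n δ A ≤ (R : ℝ≥0∞) ^ δ := by
  simpa using hContent_le_tsum (ι := Unit) hδ (fun _ => x₀) (fun _ => R)
    (subset_iUnion_of_subset () hA)

theorem exists_cover_tsum_le {n : ℕ} {δ : ℝ} (hδ : 0 < δ)
    {A : Set (EuclideanSpace ℝ (Fin n))} {x₀ : EuclideanSpace ℝ (Fin n)} {R : ℝ≥0}
    (hA : A ⊆ ball x₀ R) {ε : ℝ≥0∞} (hε : ε ≠ 0) :
    ∃ (x : ℕ → EuclideanSpace ℝ (Fin n)) (r : ℕ → ℝ≥0), A ⊆ ⋃ i, ball (x i) (r i) ∧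
      (∀ i, r i ≤ R) ∧ ∑' i, (r i : ℝ≥0∞) ^ δ ≤ hContent n δ A + ε := by
  have hfin : hContent n δ A ≠ ∞ :=
    ((hContent_le_rpow hδ hA).trans_lt (ENNReal.rpow_lt_top_of_nonneg hδ.le (by simp))).ne
  have hlt : hContent n δ A < hContent n δ A + ε := ENNReal.lt_add_right hfin hε
  obtain ⟨x, r, hcov, hsum⟩ : ∃ (x : ℕ → EuclideanSpace ℝ (Fin n)) (r : ℕ → ℝ≥0),
      ∃ _ : A ⊆ ⋃ i, ball (x i) (r i), ∑' i, (r i : ℝ≥0∞) ^ δ < hContent n δ A + ε := by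
    simpa only [hContent, iInf_lt_iff] using hlt
  by_cases hR : ∀ i, r i ≤ R
  · exact ⟨x, r, hcov, hR, hsum.le⟩
  push Not at hR
  obtain ⟨i, hi⟩ := hR
  refine ⟨fun _ => x₀, Pi.single 0 R, ?_, ?_, ?_⟩
  · exact subset_iUnion_of_subset 0 (by simpa using hA)
  · intro j
    rcases eq_or_ne j 0 with rfl | hj <;> simp [*]
  · refine le_trans ?_ hsum.le
    rw [tsum_eq_single 0 fun j hj => by simp [hj, hδ]]
    refine le_trans ?_ (ENNReal.le_tsum i)
    simp only [Pi.single_eq_same]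
    gcongr

theorem mul_hContent_le_measure_univ {n : ℕ} {δ : ℝ} (hδ : 0 < δ)
    {A : Set (EuclideanSpace ℝ (Fin n))} (ν : Measure (EuclideanSpace ℝ (Fin n))) [SFinite ν]
    {R : ℝ} {τ : ℝ≥0∞} (hτ : τ ≠ 0)
    (h : ∀ x ∈ A, ∃ ρ : ℝ≥0, 0 < ρ ∧ ρ ≤ R ∧ τ * (ρ : ℝ≥0∞) ^ δ ≤ ν (closedBall x ρ)) :
    τ * hContent n δ A ≤ 6 ^ δ * ν univ := by
  choose! ρ hρ0 hρR hρ using h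
  obtain ⟨S, hSA, hdisj, hcov⟩ := Vitali.exists_disjoint_subfamily_covering_enlargement_closedBall
    A id (fun x => (ρ x : ℝ)) R hρR 5 (by norm_num)
  have hpos : ∀ x ∈ S, 0 < ν (closedBall x (ρ x)) := fun x hx =>
    (ENNReal.mul_pos hτ (ENNReal.rpow_pos (by simpa using hρ0 x (hSA hx)) (by simp)).ne').trans_le
      (hρ x (hSA hx))
  have hcount : Countable S := by
    have := Measure.countable_meas_pos_of_disjoint_iUnion (μ := ν)
      (As := fun x : S => closedBall (x : EuclideanSpace ℝ (Fin n)) (ρ x))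
      (fun _ => measurableSet_closedBall) (fun i j hij => hdisj i.2 j.2 (Subtype.coe_ne_coe.2 hij))
    rw [← Set.countable_univ_iff]
    exact this.mono fun x _ => hpos x x.2
  have hle : hContent n δ A ≤ ∑' x : S, ((6 * ρ x : ℝ≥0) : ℝ≥0∞) ^ δ := by
    refine hContent_le_tsum hδ (fun x : S => (x : EuclideanSpace ℝ (Fin n))) _ fun x hx => ?_
    obtain ⟨y, hy, hxy⟩ := hcov x hx
    refine mem_iUnion.2 ⟨⟨y, hy⟩, ?_⟩
    have := hxy (mem_closedBall_self (ρ x).2)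
    refine closedBall_subset_ball ?_ this
    have := hρ0 y (hSA hy)
    push_cast
    have : (0 : ℝ) < ρ y := this
    linarith
  calc τ * hContent n δ A ≤ τ * ∑' x : S, ((6 * ρ x : ℝ≥0) : ℝ≥0∞) ^ δ := by gcongr
    _ = 6 ^ δ * ∑' x : S, τ * (ρ x : ℝ≥0∞) ^ δ := by
        rw [← ENNReal.tsum_mul_left, ← ENNReal.tsum_mul_left]
        refine tsum_congr fun x => ?_
        rw [ENNReal.coe_mul, ENNReal.mul_rpow_of_nonneg _ _ hδ.le]
        push_cast
        ring
    _ ≤ 6 ^ δ * ∑' x : S, ν (closedBall (x : EuclideanSpace ℝ (Fin n)) (ρ x)) := by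
        gcongr with x
        exact hρ x (hSA x.2)
    _ ≤ 6 ^ δ * ν univ := by
        gcongr
        exact tsum_measure_le_measure_univ (fun _ => measurableSet_closedBall.nullMeasurableSet)
          fun i j hij => (hdisj i.2 j.2 (Subtype.coe_ne_coe.2 hij)).aedisjoint

theorem exists_lipschitz_john_curve {n : ℕ} {α β : ℝ} (hα : 0 < α) (hαβ : α ≤ β)
    {Ω : Set (EuclideanSpace ℝ (Fin n))} (hΩ : IsOpen Ω) {x₀ : EuclideanSpace ℝ (Fin n)}
    (hJ : IsJohnDomainWithCenter n α β Ω x₀) :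
    ∃ T : ℝ, 0 ≤ T ∧ T ≤ β ∧ ∀ x ∈ Ω, ∃ γ : ℝ → EuclideanSpace ℝ (Fin n),
      LipschitzWith 1 γ ∧ γ 0 = x ∧ γ T = x₀ ∧
        ∀ t ∈ Icc 0 T, closedBall (γ t) (α / (2 * β) * t) ⊆ Ω := by
  have hβ : 0 < β := hα.trans_le hαβ
  refine ⟨min β (β / α * infDist x₀ (frontier Ω)),
    le_min hβ.le (mul_nonneg (div_nonneg hβ.le hα.le) infDist_nonneg), min_le_left _ _, ?_⟩
  intro x hx
  obtain ⟨L, hL0, hLβ, γ, hγ0, hγL, hγΩ, hγlip, hγd⟩ := hJ.2 x hx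
  have hLT : L ≤ min β (β / α * infDist x₀ (frontier Ω)) := by
    refine le_min hLβ ?_
    have := hγd L (right_mem_Icc.2 hL0)
    rw [hγL] at this
    calc L = β / α * (α / β * L) := by field_simp
      _ ≤ _ := by gcongr
  have hle : ∀ t, L ≤ t → IccExtend hL0 ((Icc 0 L).domRestrict γ) t = x₀ := fun t ht => by
    rw [IccExtend_of_right_le _ _ ht]
    exact hγL
  refine ⟨IccExtend hL0 ((Icc 0 L).domRestrict γ), ?_, ?_, hle _ hLT, ?_⟩
  · have := hγlip.to_restrict.comp (LipschitzWith.projIcc hL0)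
    rwa [mul_one] at this
  · rw [IccExtend_of_le_left _ _ le_rfl]
    exact hγ0
  · intro t ht
    have key : IccExtend hL0 ((Icc 0 L).domRestrict γ) t ∈ Ω ∧
        α / β * t ≤ infDist (IccExtend hL0 ((Icc 0 L).domRestrict γ) t) (frontier Ω) := by
      rcases le_total t L with htL | htL
      · rw [IccExtend_of_mem _ _ ⟨ht.1, htL⟩]
        exact ⟨hγΩ t ⟨ht.1, htL⟩, hγd t ⟨ht.1, htL⟩⟩
      · rw [hle t htL]
        refine ⟨hJ.1, ?_⟩
        calc α / β * t ≤ α / β * (β / α * infDist x₀ (frontier Ω)) := by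
              gcongr
              exact ht.2.trans (min_le_right _ _)
          _ = _ := by field_simp
    rcases ht.1.eq_or_lt with rfl | ht0
    · simpa using key.1
    · refine (closedBall_subset_ball ?_).trans (ball_infDist_frontier_subset hΩ key.1)
      refine lt_of_lt_of_le ?_ key.2
      have : α / (2 * β) * t = α / β * t / 2 := by field_simp
      rw [this]
      exact half_lt_self (by positivity)

theorem enorm_sub_integral_le_lintegral_fderiv {F : Type*} [NormedAddCommGroup F]
    [NormedSpace ℝ F] [FiniteDimensional ℝ F] [MeasurableSpace F] [BorelSpace F] {Ω : Set F}
    (hΩ : IsOpen Ω) {u : F → ℝ} (hu : ContDiffOn ℝ 1 u Ω) {T κ : ℝ} (hT : 0 ≤ T) (hκ : 0 ≤ κ)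
    (hκ1 : κ ≤ 1) {γ : ℝ → F} (hγ : LipschitzWith 1 γ)
    (hγΩ : ∀ t ∈ Icc 0 T, closedBall (γ t) (κ * t) ⊆ Ω) (μ : Measure F)
    [IsProbabilityMeasure μ] (hμ : ∀ᵐ y ∂μ, y ∈ closedBall (0 : F) 1) :
    ‖u (γ 0) - ∫ y, u (γ T + (κ * T) • y) ∂μ‖ₑ ≤
      2 * ∫⁻ t in Ioc 0 T, ∫⁻ y, ‖fderiv ℝ u (γ t + (κ * t) • y)‖ₑ ∂μ := by
  have : ProperSpace F := FiniteDimensional.proper_real F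
  have hmem : ∀ t ∈ Icc 0 T, ∀ y ∈ closedBall (0 : F) 1, γ t + (κ * t) • y ∈ Ω := by
    intro t ht y hy
    refine hγΩ t ht ?_
    rw [mem_closedBall_zero_iff] at hy
    rw [mem_closedBall_iff_norm, add_sub_cancel_left, norm_smul,
      Real.norm_of_nonneg (mul_nonneg hκ ht.1)]
    exact mul_le_of_le_one_right (mul_nonneg hκ ht.1) hy
  have hu_int : Integrable (fun y => u (γ T + (κ * T) • y)) μ := by
    have hc : ContinuousOn (fun y => u (γ T + (κ * T) • y)) (closedBall (0 : F) 1) :=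
      hu.continuousOn.comp (by fun_prop) (hmem T (right_mem_Icc.2 hT))
    have := hc.integrableOn_compact (μ := μ) (isCompact_closedBall _ _)
    rwa [IntegrableOn, Measure.restrict_eq_self_of_ae_mem hμ] at this
  have hmeas : Measurable fun z : F × ℝ => ‖fderiv ℝ u (γ z.2 + (κ * z.2) • z.1)‖ₑ := by
    refine ((measurable_fderiv ℝ u).comp (g := fderiv ℝ u) ?_).enorm
    have := hγ.continuous
    exact Continuous.measurable (by fun_prop)
  calc ‖u (γ 0) - ∫ y, u (γ T + (κ * T) • y) ∂μ‖ₑ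
      = ‖∫ y, (u (γ 0) - u (γ T + (κ * T) • y)) ∂μ‖ₑ := by
        rw [integral_sub (integrable_const _) hu_int]
        simp
    _ ≤ ∫⁻ y, ‖u (γ 0) - u (γ T + (κ * T) • y)‖ₑ ∂μ := enorm_integral_le_lintegral_enorm _
    _ ≤ ∫⁻ y, (2 * ∫⁻ t in Ioc 0 T, ‖fderiv ℝ u (γ t + (κ * t) • y)‖ₑ) ∂μ := by
        refine lintegral_mono_ae (hμ.mono fun y hy => ?_)
        have hlip : LipschitzOnWith 2 (fun t => γ t + (κ * t) • y) (Icc 0 T) := by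
          have h1 : LipschitzWith 1 fun t : ℝ => (κ * t) • y := by
            refine LipschitzWith.of_dist_le_mul fun s t => ?_
            rw [dist_eq_norm, ← sub_smul, norm_smul, ← mul_sub, norm_mul, Real.norm_of_nonneg hκ,
              dist_eq_norm, NNReal.coe_one, one_mul]
            rw [mem_closedBall_zero_iff] at hy
            calc κ * ‖s - t‖ * ‖y‖ ≤ 1 * ‖s - t‖ * 1 := by gcongr
              _ = _ := by ring
          have := (hγ.add h1).lipschitzOnWith (s := Icc 0 T)
          rwa [one_add_one_eq_two] at this
        have := enorm_sub_le_lintegral_fderiv_of_curve hΩ hu hT hlip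
          fun t ht => hmem t ht y hy
        rw [enorm_sub_rev]
        simpa using this
    _ = 2 * ∫⁻ t in Ioc 0 T, ∫⁻ y, ‖fderiv ℝ u (γ t + (κ * t) • y)‖ₑ ∂μ := by
        rw [lintegral_const_mul _ (Measurable.lintegral_prod_right' (f := fun z : F × ℝ =>
          ‖fderiv ℝ u (γ z.2 + (κ * z.2) • z.1)‖ₑ) hmeas),
          lintegral_lintegral_swap hmeas.aemeasurable]

theorem lintegral_Ioi_rpow_neg_le {n : ℕ} (hn : 2 ≤ n) {c : ℝ} (hc : 0 < c) :
    ∫⁻ s in Ioi c, ENNReal.ofReal ((s ^ n)⁻¹) ≤ ENNReal.ofReal ((c⁻¹) ^ (n - 1)) := by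
  have hn2 : (2 : ℝ) ≤ n := by exact_mod_cast hn
  have ha : (-n : ℝ) < -1 := by linarith
  have heq : ∀ s ∈ Ioi c, ENNReal.ofReal ((s ^ n)⁻¹) = ENNReal.ofReal (s ^ (-n : ℝ)) :=
    fun s hs => by rw [Real.rpow_neg (hc.trans hs).le, Real.rpow_natCast]
  rw [setLIntegral_congr_fun measurableSet_Ioi heq, ← ofReal_integral_eq_lintegral_ofReal
    (integrableOn_Ioi_rpow_of_lt ha hc) (ae_restrict_of_forall_mem measurableSet_Ioi
      fun s hs => Real.rpow_nonneg (hc.trans hs).le _), integral_Ioi_rpow_of_lt ha hc]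
  refine ENNReal.ofReal_le_ofReal ?_
  have h1 : c ^ (-n + 1 : ℝ) = (c⁻¹) ^ (n - 1) := by
    rw [inv_pow, ← Real.rpow_natCast, ← Real.rpow_neg hc.le]
    congr 1
    rw [Nat.cast_sub (by lia)]
    push_cast
    ring
  rw [h1, ← neg_div_neg_eq, neg_neg]
  exact div_le_self (by positivity) (by linarith)

theorem lintegral_measure_preimage_ball_le {F : Type*} [NormedAddCommGroup F]
    [NormedSpace ℝ F] [MeasurableSpace F] {n : ℕ} (hn : 2 ≤ n)
    (μ : Measure F) [IsProbabilityMeasure μ] (hμ : ∀ᵐ y ∂μ, y ∈ closedBall (0 : F) 1)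
    (hμb : ∀ (c : F) (r : ℝ), 0 ≤ r → μ (ball c r) ≤ ENNReal.ofReal (r ^ n))
    {T κ β : ℝ} (hTβ : T ≤ β) (hβ : 0 < β) (hκ : 0 < κ) (hκ1 : κ ≤ 1) {γ : ℝ → F}
    (hγ : LipschitzWith 1 γ) (c : F) {r : ℝ} (hr : 0 < r) (hrβ : r ≤ 2 * β) :
    (∃ m : ℕ, dist c (γ 0) ≤ 4 * β / 2 ^ m ∧
      ∫⁻ t in Ioc 0 T, μ ((fun y => γ t + (κ * t) • y) ⁻¹' ball c r) ≤
        ENNReal.ofReal ((2 * r / κ) ^ n * (2 ^ m / β) ^ (n - 1))) ∨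
    ∫⁻ t in Ioc 0 T, μ ((fun y => γ t + (κ * t) • y) ⁻¹' ball c r) = 0 := by
  set D := max r (dist c (γ 0)) with hD
  have hDpos : 0 < D := hr.trans_le (le_max_left _ _)
  have hnonzero : ∀ t, 0 < t → μ ((fun y => γ t + (κ * t) • y) ⁻¹' ball c r) ≠ 0 →
      dist c (γ 0) < 2 * t + r := by
    intro t ht h0
    obtain ⟨y, hy1, hy⟩ : ∃ y, y ∈ (fun y => γ t + (κ * t) • y) ⁻¹' ball c r ∧
        y ∈ closedBall (0 : F) 1 := by
      by_contra! hcon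
      exact h0 (measure_mono_null hcon hμ)
    rw [mem_closedBall_zero_iff] at hy
    have h1 : dist (γ t + (κ * t) • y) c < r := hy1
    have h2 : dist (γ t + (κ * t) • y) (γ t) ≤ t := by
      rw [dist_eq_norm, add_sub_cancel_left, norm_smul, Real.norm_of_nonneg (by positivity)]
      calc κ * t * ‖y‖ ≤ 1 * t * 1 := by gcongr
        _ = t := by ring
    have h3 : dist (γ t) (γ 0) ≤ t := by
      simpa [abs_of_pos ht] using hγ.dist_le_mul t 0
    have h4 := dist_triangle4 c (γ t + (κ * t) • y) (γ t) (γ 0)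
    rw [dist_comm c (γ t + _)] at h4
    linarith
  have hbound : ∀ t, 0 < t → μ ((fun y => γ t + (κ * t) • y) ⁻¹' ball c r) ≤
      ENNReal.ofReal ((2 * r / κ) ^ n) * ENNReal.ofReal (((t + r) ^ n)⁻¹) := by
    intro t ht
    rw [← ENNReal.ofReal_mul (by positivity)]
    have heq : (2 * r / κ) ^ n * ((t + r) ^ n)⁻¹ = (2 * r / (κ * (t + r))) ^ n := by
      rw [← inv_pow, ← mul_pow]
      congr 1
      field_simp
    rw [heq]
    rcases le_total t r with htr | htr
    · refine prob_le_one.trans (ENNReal.one_le_ofReal.2 (one_le_pow₀ ?_))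
      rw [one_le_div (by positivity)]
      nlinarith
    · have hpre : (fun y => γ t + (κ * t) • y) ⁻¹' ball c r =
          ball ((κ * t)⁻¹ • (c - γ t)) (r / (κ * t)) := by
        ext y
        have hκt : 0 < κ * t := by positivity
        have : γ t + (κ * t) • y - c = (κ * t) • (y - (κ * t)⁻¹ • (c - γ t)) := by
          rw [smul_sub, smul_inv_smul₀ hκt.ne']
          abel
        rw [mem_preimage, mem_ball_iff_norm, mem_ball_iff_norm, this, norm_smul,
          Real.norm_of_nonneg hκt.le, lt_div_iff₀' hκt]
      rw [hpre]
      refine (hμb _ _ (by positivity)).trans (ENNReal.ofReal_le_ofReal ?_)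
      gcongr ?_ ^ n
      rw [div_le_div_iff₀ (by positivity) (by positivity)]
      nlinarith [mul_pos hr hκ]
  by_cases hbig : 4 * β < D
  · right
    refine (setLIntegral_congr_fun measurableSet_Ioc fun t ht => ?_).trans lintegral_zero
    by_contra h0
    have h1 := hnonzero t ht.1 h0
    have h2 := lt_max_iff.1 hbig
    rcases h2 with h2 | h2 <;> linarith [ht.2]
  left
  push Not at hbig
  obtain ⟨m, hm1, hm2⟩ := exists_nat_pow_near_of_lt_one (x := D / (4 * β)) (y := 1 / 2)
    (by positivity) ((div_le_one (by positivity)).2 hbig) (by norm_num) (by norm_num)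
  rw [lt_div_iff₀ (by positivity)] at hm1
  rw [div_le_iff₀ (by positivity)] at hm2
  have hρ : D ≤ 4 * β / 2 ^ m := by
    refine hm2.trans_eq ?_
    rw [one_div, inv_pow]; field_simp
  refine ⟨m, (le_max_right _ _).trans hρ, ?_⟩
  calc ∫⁻ t in Ioc 0 T, μ ((fun y => γ t + (κ * t) • y) ⁻¹' ball c r)
      ≤ ∫⁻ t in Ioc 0 T, ENNReal.ofReal ((2 * r / κ) ^ n) *
          (Ioi (D / 2)).indicator (fun s => ENNReal.ofReal ((s ^ n)⁻¹)) (t + r) := by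
        refine setLIntegral_mono' measurableSet_Ioc fun t ht => ?_
        by_cases h0 : μ ((fun y => γ t + (κ * t) • y) ⁻¹' ball c r) = 0
        · rw [h0]; exact zero_le
        · have hd := hnonzero t ht.1 h0
          have hDt : D < 2 * (t + r) := max_lt (by linarith [ht.1]) (by linarith)
          rw [indicator_of_mem (by rw [mem_Ioi]; linarith)]
          exact hbound t ht.1
    _ ≤ ∫⁻ t, ENNReal.ofReal ((2 * r / κ) ^ n) *
          (Ioi (D / 2)).indicator (fun s => ENNReal.ofReal ((s ^ n)⁻¹)) (t + r) :=
        setLIntegral_le_lintegral _ _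
    _ = ENNReal.ofReal ((2 * r / κ) ^ n) * ∫⁻ s in Ioi (D / 2), ENNReal.ofReal ((s ^ n)⁻¹) := by
        rw [lintegral_const_mul' _ _ (by simp), lintegral_add_right_eq_self
          (fun s => (Ioi (D / 2)).indicator (fun s => ENNReal.ofReal ((s ^ n)⁻¹)) s),
          lintegral_indicator measurableSet_Ioi]
    _ ≤ ENNReal.ofReal ((2 * r / κ) ^ n) * ENNReal.ofReal (((D / 2)⁻¹) ^ (n - 1)) := by
        gcongr
        exact lintegral_Ioi_rpow_neg_le hn (by positivity)
    _ ≤ _ := by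
        rw [← ENNReal.ofReal_mul (by positivity)]
        refine ENNReal.ofReal_le_ofReal ?_
        gcongr
        rw [inv_div, div_le_div_iff₀ hDpos hβ]
        rw [pow_succ, one_div, inv_pow] at hm1
        have h2 : (0 : ℝ) < 2 ^ m := by positivity
        calc 2 * β = 2 ^ m * ((2 ^ m)⁻¹ * 2⁻¹ * (4 * β)) := by field_simp; norm_num
          _ ≤ 2 ^ m * D := by gcongr

theorem exists_isProbabilityMeasure_closedBall {n : ℕ} (hn : n ≠ 0) :
    ∃ μ : Measure (EuclideanSpace ℝ (Fin n)), IsProbabilityMeasure μ ∧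
      (∀ᵐ y ∂μ, y ∈ closedBall 0 1) ∧
      ∀ c r, 0 ≤ r → μ (ball c r) ≤ ENNReal.ofReal (r ^ n) := by
  have : NeZero n := ⟨hn⟩
  have hpos : volume (closedBall (0 : EuclideanSpace ℝ (Fin n)) 1) ≠ 0 :=
    (measure_closedBall_pos _ _ one_pos).ne'
  have hfin : volume (closedBall (0 : EuclideanSpace ℝ (Fin n)) 1) ≠ ∞ :=
    measure_closedBall_lt_top.ne
  refine ⟨ProbabilityTheory.cond volume (closedBall 0 1),
    ProbabilityTheory.cond_isProbabilityMeasure_of_finite hpos hfin,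
    ProbabilityTheory.ae_cond_mem measurableSet_closedBall, fun c r hr => ?_⟩
  rw [ProbabilityTheory.cond_apply measurableSet_closedBall]
  calc _ ≤ (volume (closedBall (0 : EuclideanSpace ℝ (Fin n)) 1))⁻¹ * volume (ball c r) := by
        gcongr
        exact inter_subset_right
    _ = ENNReal.ofReal (r ^ n) := by
        rw [Measure.addHaar_ball _ _ hr, ← Measure.addHaar_unitClosedBall_eq_addHaar_unitBall,
          finrank_euclideanSpace_fin, mul_left_comm, ENNReal.inv_mul_cancel hpos hfin, mul_one]

theorem tsum_mul_indicator_eq_sum_dirac {F ι κ : Type*} [MeasurableSpace F]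
    (x : ι → F) (w : ι → ℝ≥0∞) (B : κ → Set F) (hB : ∀ m, MeasurableSet (B m))
    (G : κ → ℝ≥0∞) :
    ∑' i, w i * ∑' m, G m * (B m).indicator 1 (x i) =
      ∑' m, G m * Measure.sum (fun i => w i • Measure.dirac (x i)) (B m) := by
  simp_rw [Measure.sum_apply _ (hB _), Measure.smul_apply, Measure.dirac_apply' _ (hB _),
    smul_eq_mul, ← ENNReal.tsum_mul_left]
  rw [ENNReal.tsum_comm]
  refine tsum_congr fun m => tsum_congr fun i => ?_
  ring

theorem lintegral_lintegral_tsum_indicator {F ι : Type*} [NormedAddCommGroup F]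
    [NormedSpace ℝ F] [MeasurableSpace F] [BorelSpace F] [SecondCountableTopology F] [Countable ι]
    (μ : Measure F) [IsProbabilityMeasure μ] {γ : ℝ → F} (hγ : Continuous γ) (κ : ℝ) {T : ℝ}
    (s : ℝ≥0∞) (a : ι → ℝ≥0∞) (B : ι → Set F) (hB : ∀ i, MeasurableSet (B i)) :
    ∫⁻ t in Ioc 0 T, ∫⁻ y, (s + ∑' i, a i * (B i).indicator 1 (γ t + (κ * t) • y)) ∂μ =
      s * ENNReal.ofReal T +
        ∑' i, a i * ∫⁻ t in Ioc 0 T, μ ((fun y => γ t + (κ * t) • y) ⁻¹' B i) := by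
  have hcont : ∀ t : ℝ, Measurable fun y : F => γ t + (κ * t) • y := fun t =>
    Continuous.measurable (by fun_prop)
  have hm : ∀ t i, Measurable fun y => a i * (B i).indicator (1 : F → ℝ≥0∞) (γ t + (κ * t) • y) :=
    fun t i => ((measurable_one.indicator (hB i)).comp (hcont t)).const_mul _
  have hinner : ∀ t : ℝ, ∫⁻ y, (s + ∑' i, a i * (B i).indicator 1 (γ t + (κ * t) • y)) ∂μ =
      s + ∑' i, a i * μ ((fun y => γ t + (κ * t) • y) ⁻¹' B i) := by
    intro t
    rw [lintegral_add_left measurable_const, lintegral_const, measure_univ, mul_one,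
      lintegral_tsum fun i => (hm t i).aemeasurable]
    congr 1
    refine tsum_congr fun i => ?_
    rw [lintegral_const_mul _
        (show Measurable fun y => (B i).indicator (1 : F → ℝ≥0∞) (γ t + (κ * t) • y) from
          (measurable_one.indicator (hB i)).comp (hcont t)),
      ← lintegral_indicator_one ((hcont t) (hB i))]
    rfl
  have hmeas : ∀ i, Measurable fun t : ℝ => μ ((fun y => γ t + (κ * t) • y) ⁻¹' B i) := by
    intro i
    have hg : Measurable fun z : ℝ × F => γ z.1 + (κ * z.1) • z.2 :=
      Continuous.measurable (by fun_prop)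
    exact measurable_measure_prodMk_left (hg (hB i))
  simp_rw [hinner]
  rw [lintegral_add_left measurable_const, setLIntegral_const, Real.volume_Ioc, sub_zero,
    lintegral_tsum fun i => ((hmeas i).const_mul _).aemeasurable]
  congr 1
  exact tsum_congr fun i => lintegral_const_mul _ (hmeas i)

theorem ofReal_le_add_tsum_two_pow {s h : ℝ} (hs : 0 < s) (b : ℕ → ℝ≥0∞)
    (hb : ∀ k, s * 2 ^ k < h → 1 ≤ b k) :
    ENNReal.ofReal h ≤ ENNReal.ofReal s + ∑' k, ENNReal.ofReal (s * 2 ^ (k + 1)) * b k := by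
  rcases le_or_gt h s with hle | hlt
  · exact (ENNReal.ofReal_le_ofReal hle).trans le_self_add
  · obtain ⟨k, hk1, hk2⟩ : ∃ k : ℕ, s * 2 ^ k < h ∧ h ≤ s * 2 ^ (k + 1) := by
      obtain ⟨k, hk, hmin⟩ : ∃ k : ℕ, h ≤ s * 2 ^ k ∧ ∀ j < k, ¬ h ≤ s * 2 ^ j := by
        have hex : ∃ k : ℕ, h ≤ s * 2 ^ k := by
          obtain ⟨k, hk⟩ := pow_unbounded_of_one_lt (h / s) one_lt_two
          exact ⟨k, by rw [div_lt_iff₀' hs] at hk; exact hk.le⟩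
        exact ⟨Nat.find hex, Nat.find_spec hex, fun j hj => Nat.find_min hex hj⟩
      rcases k with _ | k
      · simp at hk
        linarith
      · exact ⟨k, not_le.1 (hmin k (Nat.lt_succ_self k)), hk⟩
    calc ENNReal.ofReal h ≤ ENNReal.ofReal (s * 2 ^ (k + 1)) * 1 := by
          rw [mul_one]; exact ENNReal.ofReal_le_ofReal hk2
      _ ≤ ENNReal.ofReal (s * 2 ^ (k + 1)) * b k := by gcongr; exact hb k hk1
      _ ≤ ∑' k, ENNReal.ofReal (s * 2 ^ (k + 1)) * b k :=
          ENNReal.le_tsum (f := fun k => ENNReal.ofReal (s * 2 ^ (k + 1)) * b k) k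
      _ ≤ _ := le_add_self

theorem rpow_lintegral_measure_preimage_ball_le {F : Type*} [NormedAddCommGroup F]
    [NormedSpace ℝ F] [MeasurableSpace F] {n : ℕ} (hn : 2 ≤ n) {δ : ℝ} (hδ : 0 < δ)
    (μ : Measure F) [IsProbabilityMeasure μ] (hμ : ∀ᵐ y ∂μ, y ∈ closedBall (0 : F) 1)
    (hμb : ∀ (c : F) (r : ℝ), 0 ≤ r → μ (ball c r) ≤ ENNReal.ofReal (r ^ n))
    {T κ β : ℝ} (hTβ : T ≤ β) (hβ : 0 < β) (hκ : 0 < κ) (hκ1 : κ ≤ 1) {γ : ℝ → F}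
    (hγ : LipschitzWith 1 γ) (c : F) {r : ℝ≥0} (hrβ : r ≤ 2 * β) :
    (∫⁻ t in Ioc 0 T, μ ((fun y => γ t + (κ * t) • y) ⁻¹' ball c r)) ^ (δ / n) ≤
      (r : ℝ≥0∞) ^ δ * ∑' m : ℕ, ENNReal.ofReal ((2 / κ) ^ δ * (2 ^ m / β) ^ (δ - δ / n)) *
        (closedBall (γ 0) (4 * β / 2 ^ m)).indicator 1 c := by
  have hn0 : (0 : ℝ) < n := by exact_mod_cast (by lia : 0 < n)
  have hq : 0 < δ / n := by positivity
  rcases eq_or_ne r 0 with rfl | hr0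
  · simp [hq]
  have hr : (0 : ℝ) < r := by exact_mod_cast pos_iff_ne_zero.2 hr0
  rcases lintegral_measure_preimage_ball_le hn μ hμ hμb hTβ hβ hκ hκ1 hγ c hr hrβ with
    ⟨m, hm, hJ⟩ | hJ
  · calc _ ≤ (ENNReal.ofReal ((2 * r / κ) ^ n * (2 ^ m / β) ^ (n - 1))) ^ (δ / n) := by gcongr
      _ = (r : ℝ≥0∞) ^ δ * (ENNReal.ofReal ((2 / κ) ^ δ * (2 ^ m / β) ^ (δ - δ / n)) *
            (closedBall (γ 0) (4 * β / 2 ^ m)).indicator 1 c) := by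
          rw [indicator_of_mem (by exact hm), Pi.one_apply, mul_one, ← ENNReal.ofReal_coe_nnreal,
            ENNReal.ofReal_rpow_of_nonneg (by positivity) hq.le,
            ENNReal.ofReal_rpow_of_nonneg hr.le hδ.le, ← ENNReal.ofReal_mul (by positivity)]
          congr 1
          rw [Real.mul_rpow (by positivity) (by positivity), ← Real.rpow_natCast,
            ← Real.rpow_natCast, ← Real.rpow_mul (by positivity), ← Real.rpow_mul (by positivity),
            Nat.cast_sub (by lia), mul_div_cancel₀ _ hn0.ne', ← mul_assoc,
            ← Real.mul_rpow hr.le (by positivity)]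
          congr 2
          · ring
          · field_simp
            push_cast
            ring
      _ ≤ _ := by
          gcongr
          exact ENNReal.le_tsum (f := fun m : ℕ => ENNReal.ofReal ((2 / κ) ^ δ *
            (2 ^ m / β) ^ (δ - δ / n)) * (closedBall (γ 0) (4 * β / 2 ^ m)).indicator 1 c) m
  · rw [hJ, ENNReal.zero_rpow_of_pos hq]
    exact zero_le

theorem tsum_ofReal_kernel_mul {δ q κ β : ℝ} (hq : 0 < q) (hβ : 0 < β) (hκ : 0 < κ) :
    ∑' m : ℕ, ENNReal.ofReal ((2 / κ) ^ δ * (2 ^ m / β) ^ (δ - q)) *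
      (ENNReal.ofReal ((κ / 8) ^ δ * (1 - 2 ^ (-q))) * ENNReal.ofReal ((4 * β / 2 ^ m) ^ δ)) =
      ENNReal.ofReal (β ^ q) := by
  have hθ1 : (2 : ℝ) ^ (-q) < 1 := Real.rpow_lt_one_of_one_lt_of_neg one_lt_two (by linarith)
  have hθ0 : (0 : ℝ) < 2 ^ (-q) := by positivity
  have h1θ : 0 < 1 - (2 : ℝ) ^ (-q) := by linarith
  have hterm : ∀ m : ℕ, ENNReal.ofReal ((2 / κ) ^ δ * (2 ^ m / β) ^ (δ - q)) *
      (ENNReal.ofReal ((κ / 8) ^ δ * (1 - 2 ^ (-q))) * ENNReal.ofReal ((4 * β / 2 ^ m) ^ δ)) =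
      ENNReal.ofReal (β ^ q * (1 - 2 ^ (-q))) * ENNReal.ofReal (2 ^ (-q)) ^ m := by
    intro m
    rw [← ENNReal.ofReal_mul (by positivity), ← ENNReal.ofReal_mul (by positivity),
      ← ENNReal.ofReal_pow hθ0.le, ← ENNReal.ofReal_mul (by positivity)]
    congr 1
    have e1 : (2 / κ) ^ δ * (κ / 8) ^ δ * (4 * β / 2 ^ m) ^ δ = (β / 2 ^ m) ^ δ := by
      rw [← Real.mul_rpow (by positivity) (by positivity),
        ← Real.mul_rpow (by positivity) (by positivity)]
      congr 1
      field_simp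
      norm_num
    have e2 : (2 ^ m / β) ^ (δ - q) = (β / 2 ^ m) ^ (q - δ) := by
      rw [← inv_div, Real.inv_rpow (by positivity), ← Real.rpow_neg (by positivity), neg_sub]
    have e3 : (β / 2 ^ m) ^ (q - δ) * (β / 2 ^ m) ^ δ = β ^ q * (2 ^ (-q)) ^ m := by
      rw [← Real.rpow_add (by positivity), sub_add_cancel, div_eq_mul_inv,
        Real.mul_rpow hβ.le (by positivity), Real.inv_rpow (by positivity),
        Real.rpow_neg (by positivity), inv_pow, ← Real.rpow_natCast, ← Real.rpow_mul (by positivity),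
        ← Real.rpow_natCast, ← Real.rpow_mul (by positivity), mul_comm (m : ℝ)]
    rw [e2]
    linear_combination (1 - 2 ^ (-q)) * (e3 + (β / 2 ^ m) ^ (q - δ) * e1)
  rw [tsum_congr hterm, ENNReal.tsum_mul_left, ENNReal.tsum_geometric, ← ENNReal.ofReal_one,
    ← ENNReal.ofReal_sub _ hθ0.le, ← ENNReal.ofReal_inv_of_pos h1θ,
    ← ENNReal.ofReal_mul (by positivity)]
  congr 1
  field_simp

theorem subset_ball_of_isJohnDomainWithCenter {n : ℕ} {α β : ℝ} (hα : 0 < α) (hαβ : α ≤ β)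
    {Ω : Set (EuclideanSpace ℝ (Fin n))} {x₀ : EuclideanSpace ℝ (Fin n)}
    (hJ : IsJohnDomainWithCenter n α β Ω x₀) : Ω ⊆ ball x₀ (2 * β) := by
  intro x hx
  obtain ⟨L, hL0, hLβ, γ, hγ0, hγL, -, hγlip, -⟩ := hJ.2 x hx
  have := hγlip.dist_le_mul 0 (left_mem_Icc.2 hL0) L (right_mem_Icc.2 hL0)
  rw [hγ0, hγL, Real.dist_eq, zero_sub, abs_neg, abs_of_nonneg hL0, NNReal.coe_one, one_mul] at this
  rw [mem_ball]
  linarith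

theorem ofReal_lt_tsum_rpow_of_lt {F : Type*} [NormedAddCommGroup F]
    [NormedSpace ℝ F] [FiniteDimensional ℝ F] [MeasurableSpace F] [BorelSpace F] {Ω : Set F}
    (hΩ : IsOpen Ω) {u : F → ℝ} (hu : ContDiffOn ℝ 1 u Ω) {T κ β : ℝ} (hT : 0 ≤ T) (hTβ : T ≤ β)
    (hβ : 0 < β) (hκ : 0 ≤ κ)
    (hκ1 : κ ≤ 1) {γ : ℝ → F} (hγ : LipschitzWith 1 γ)
    (hγΩ : ∀ t ∈ Icc 0 T, closedBall (γ t) (κ * t) ⊆ Ω) (μ : Measure F)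
    [IsProbabilityMeasure μ] (hμ : ∀ᵐ y ∂μ, y ∈ closedBall (0 : F) 1)
    {s : ℝ} (hs : 0 < s) (x : ℕ → ℕ → F) (r : ℕ → ℕ → ℝ≥0)
    (hcov : ∀ k : ℕ, {z ∈ Ω | s * 2 ^ k < ‖fderiv ℝ u z‖} ⊆ ⋃ j, ball (x k j) (r k j))
    (hlt : 4 * β * s < |u (γ 0) - ∫ y, u (γ T + (κ * T) • y) ∂μ|) {q : ℝ} (hq : 0 < q)
    (hq1 : q ≤ 1) :
    ENNReal.ofReal (β ^ q) < ∑' i : ℕ × ℕ, (2 ^ q) ^ (i.1 + 1) *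
      (∫⁻ t in Ioc 0 T, μ ((fun y => γ t + (κ * t) • y) ⁻¹' ball (x i.1 i.2) (r i.1 i.2))) ^ q := by
  have : ProperSpace F := FiniteDimensional.proper_real F
  set J : ℕ × ℕ → ℝ≥0∞ := fun i =>
    ∫⁻ t in Ioc 0 T, μ ((fun y => γ t + (κ * t) • y) ⁻¹' ball (x i.1 i.2) (r i.1 i.2)) with hJ
  set S : ℝ≥0∞ := ∑' i, ENNReal.ofReal (s * 2 ^ (i.1 + 1)) * J i with hS
  have hptw : ∀ z ∈ Ω, ‖fderiv ℝ u z‖ₑ ≤ ENNReal.ofReal s + ∑' i : ℕ × ℕ,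
      ENNReal.ofReal (s * 2 ^ (i.1 + 1)) * (ball (x i.1 i.2) (r i.1 i.2)).indicator 1 z := by
    intro z hz
    rw [← ofReal_norm]
    refine (ofReal_le_add_tsum_two_pow hs
      (fun k => ∑' j, (ball (x k j) (r k j)).indicator 1 z) fun k hk => ?_).trans_eq ?_
    · obtain ⟨j, hj⟩ := mem_iUnion.1 (hcov k ⟨hz, hk⟩)
      calc (1 : ℝ≥0∞) = (ball (x k j) (r k j)).indicator 1 z := by
            rw [indicator_of_mem hj, Pi.one_apply]
        _ ≤ _ := ENNReal.le_tsum (f := fun j => (ball (x k j) (r k j)).indicator 1 z) j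
    · rw [ENNReal.tsum_prod']
      simp_rw [ENNReal.tsum_mul_left]
  have hle : ‖u (γ 0) - ∫ y, u (γ T + (κ * T) • y) ∂μ‖ₑ ≤
      2 * (ENNReal.ofReal (s * β) + S) := by
    refine (enorm_sub_integral_le_lintegral_fderiv hΩ hu hT hκ hκ1 hγ hγΩ μ hμ).trans ?_
    gcongr
    calc _ ≤ ∫⁻ t in Ioc 0 T, ∫⁻ y, (ENNReal.ofReal s + ∑' i : ℕ × ℕ,
          ENNReal.ofReal (s * 2 ^ (i.1 + 1)) *
            (ball (x i.1 i.2) (r i.1 i.2)).indicator 1 (γ t + (κ * t) • y)) ∂μ := by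
          refine setLIntegral_mono_ae' measurableSet_Ioc (.of_forall fun t ht => ?_)
          refine lintegral_mono_ae (hμ.mono fun y hy => hptw _ (hγΩ t ⟨ht.1.le, ht.2⟩ ?_))
          rw [mem_closedBall_zero_iff] at hy
          have := mul_nonneg hκ ht.1.le
          rw [mem_closedBall_iff_norm, add_sub_cancel_left, norm_smul, Real.norm_of_nonneg this]
          exact mul_le_of_le_one_right this hy
      _ = ENNReal.ofReal s * ENNReal.ofReal T + S :=
          lintegral_lintegral_tsum_indicator μ hγ.continuous κ _ _ _ fun _ => measurableSet_ball
      _ ≤ _ := by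
          rw [← ENNReal.ofReal_mul hs.le]
          gcongr
  have hSlt : ENNReal.ofReal (s * β) < S := by
    by_contra! hcon
    have h1 := hle.trans (b := 2 * (ENNReal.ofReal (s * β) + S))
      (c := 2 * (ENNReal.ofReal (s * β) + ENNReal.ofReal (s * β))) (by gcongr)
    rw [← ENNReal.ofReal_add (by positivity) (by positivity), ← ENNReal.ofReal_ofNat 2,
      ← ENNReal.ofReal_mul (by positivity), ← ofReal_norm,
      ENNReal.ofReal_le_ofReal_iff (by positivity), Real.norm_eq_abs] at h1
    linarith
  have hs0 : ENNReal.ofReal s ^ q ≠ 0 :=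
    (ENNReal.rpow_pos (ENNReal.ofReal_pos.2 hs) ENNReal.ofReal_ne_top).ne'
  have hsT : ENNReal.ofReal s ^ q ≠ ∞ := ENNReal.rpow_ne_top_of_nonneg hq.le ENNReal.ofReal_ne_top
  rw [← ENNReal.mul_lt_mul_iff_right hs0 hsT, ← ENNReal.tsum_mul_left]
  calc ENNReal.ofReal s ^ q * ENNReal.ofReal (β ^ q) = ENNReal.ofReal (s * β) ^ q := by
        rw [ENNReal.ofReal_mul hs.le, ENNReal.mul_rpow_of_nonneg _ _ hq.le,
          ENNReal.ofReal_rpow_of_nonneg hβ.le hq.le]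
    _ < S ^ q := ENNReal.rpow_lt_rpow hSlt hq
    _ ≤ ∑' i, (ENNReal.ofReal (s * 2 ^ (i.1 + 1)) * J i) ^ q :=
        ENNReal.rpow_tsum_le_tsum_rpow _ hq hq1
    _ = _ := by
        refine tsum_congr fun i => ?_
        rw [ENNReal.ofReal_mul hs.le, ENNReal.mul_rpow_of_nonneg _ _ hq.le,
          ENNReal.mul_rpow_of_nonneg _ _ hq.le, ENNReal.ofReal_pow zero_le_two,
          ENNReal.ofReal_ofNat, mul_assoc, ← ENNReal.rpow_natCast, ← ENNReal.rpow_natCast,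
          ← ENNReal.rpow_mul, ← ENNReal.rpow_mul, mul_comm q]

theorem exists_mul_hContent_level_le {n : ℕ} (hn : 2 ≤ n) {δ : ℝ} (hδ : 0 < δ)
    (hδn : δ ≤ n) {α β : ℝ} (hα : 0 < α) (hαβ : α ≤ β)
    {Ω : Set (EuclideanSpace ℝ (Fin n))} (hΩ : IsOpen Ω) (hJ : IsJohnDomain n α β Ω)
    {u : EuclideanSpace ℝ (Fin n) → ℝ} (hu : ContDiffOn ℝ 1 u Ω) :
    ∃ b : ℝ, ∀ s : ℝ, 0 < s →
      ENNReal.ofReal ((α / (2 * β) / 8) ^ δ * (1 - 2 ^ (-(δ / n)))) *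
          hContent n δ {x ∈ Ω | 4 * β * s < |u x - b|} ≤
        6 ^ δ * ∑' k : ℕ, (2 ^ (δ / n)) ^ (k + 1) *
          hContent n δ {x ∈ Ω | s * 2 ^ k < ‖fderiv ℝ u x‖} := by
  have hβ : 0 < β := hα.trans_le hαβ
  have hn0 : (0 : ℝ) < n := by exact_mod_cast (by lia : 0 < n)
  set q := δ / n with hq_def
  have hq : 0 < q := by positivity
  have hq1 : q ≤ 1 := (div_le_one hn0).2 hδn
  set κ := α / (2 * β) with hκ_def
  have hκ : 0 < κ := by positivity
  have hκ1 : κ ≤ 1 := (div_le_one (by positivity)).2 (by linarith)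
  have hθ1 : (2 : ℝ) ^ (-q) < 1 := Real.rpow_lt_one_of_one_lt_of_neg one_lt_two (by linarith)
  obtain ⟨x₀, hJ⟩ := hJ
  obtain ⟨T, hT, hTβ, hcurve⟩ := exists_lipschitz_john_curve hα hαβ hΩ hJ
  obtain ⟨μ, hμp, hμ, hμb⟩ := exists_isProbabilityMeasure_closedBall (n := n) (by lia)
  refine ⟨∫ y, u (x₀ + (κ * T) • y) ∂μ, fun s hs => ?_⟩
  refine ENNReal.le_of_forall_pos_le_add fun ε hε _ => ?_
  obtain ⟨ε', hε'0, hε'⟩ := ENNReal.exists_pos_sum_of_countable'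
    (ε := ε) (by simpa using hε.ne') ℕ
  have hc0 : ∀ k : ℕ, (6 : ℝ≥0∞) ^ δ * (2 ^ q) ^ (k + 1) ≠ 0 := fun k =>
    mul_ne_zero (ENNReal.rpow_pos (by simp) (by simp)).ne'
      (pow_ne_zero _ (ENNReal.rpow_pos (by simp) (by simp)).ne')
  have hcT : ∀ k : ℕ, (6 : ℝ≥0∞) ^ δ * (2 ^ q) ^ (k + 1) ≠ ∞ := fun k =>
    ENNReal.mul_ne_top (ENNReal.rpow_ne_top_of_nonneg hδ.le (by simp))
      (ENNReal.pow_ne_top (ENNReal.rpow_ne_top_of_nonneg hq.le (by simp)))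
  have hΩR : Ω ⊆ ball x₀ (⟨2 * β, by positivity⟩ : ℝ≥0) :=
    subset_ball_of_isJohnDomainWithCenter hα hαβ hJ
  choose x r hcov hrR hsum using fun k : ℕ => exists_cover_tsum_le hδ
    (A := {x ∈ Ω | s * 2 ^ k < ‖fderiv ℝ u x‖}) ((sep_subset _ _).trans hΩR)
    (ε := ε' k / (6 ^ δ * (2 ^ q) ^ (k + 1)))
    (ENNReal.div_pos (hε'0 k).ne' (hcT k)).ne'
  set w : ℕ × ℕ → ℝ≥0∞ := fun i => (2 ^ q) ^ (i.1 + 1) * (r i.1 i.2 : ℝ≥0∞) ^ δ with hw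
  set ν := Measure.sum fun i : ℕ × ℕ => w i • Measure.dirac (x i.1 i.2) with hν
  have hτ : ENNReal.ofReal ((κ / 8) ^ δ * (1 - 2 ^ (-q))) ≠ 0 :=
    (ENNReal.ofReal_pos.2 (mul_pos (by positivity) (by linarith))).ne'
  refine (mul_hContent_le_measure_univ hδ ν (R := 4 * β) hτ ?_).trans ?_
  · rintro z ⟨hzΩ, hz⟩
    obtain ⟨γ, hγ, hγ0, hγT, hγΩ⟩ := hcurve z hzΩ
    by_contra! hcon
    rw [← hγ0, ← hγT] at hz
    have h1 := ofReal_lt_tsum_rpow_of_lt hΩ hu hT hTβ hβ hκ.le hκ1 hγ hγΩ μ hμ hs x r hcov hz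
      hq hq1
    refine h1.not_ge ?_
    calc _ ≤ ∑' i : ℕ × ℕ, w i * ∑' m : ℕ,
          ENNReal.ofReal ((2 / κ) ^ δ * (2 ^ m / β) ^ (δ - q)) *
            (closedBall (γ 0) (4 * β / 2 ^ m)).indicator 1 (x i.1 i.2) := by
          refine ENNReal.tsum_le_tsum fun i => ?_
          simp only [hw]
          rw [mul_assoc]
          gcongr
          exact rpow_lintegral_measure_preimage_ball_le hn hδ μ hμ hμb hTβ hβ hκ hκ1 hγ _
            (hrR i.1 i.2)
      _ = ∑' m : ℕ, ENNReal.ofReal ((2 / κ) ^ δ * (2 ^ m / β) ^ (δ - q)) *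
            ν (closedBall (γ 0) (4 * β / 2 ^ m)) :=
          tsum_mul_indicator_eq_sum_dirac _ _ _ (fun _ => measurableSet_closedBall) _
      _ ≤ ∑' m : ℕ, ENNReal.ofReal ((2 / κ) ^ δ * (2 ^ m / β) ^ (δ - q)) *
          (ENNReal.ofReal ((κ / 8) ^ δ * (1 - 2 ^ (-q))) *
            ENNReal.ofReal ((4 * β / 2 ^ m) ^ δ)) := by
          gcongr with m
          have hρ : 0 < 4 * β / 2 ^ m := by positivity
          have := hcon (⟨4 * β / 2 ^ m, hρ.le⟩ : ℝ≥0) hρ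
            (div_le_self (by positivity) (one_le_pow₀ one_le_two))
          rw [hγ0, ← ENNReal.ofReal_rpow_of_nonneg hρ.le hδ.le,
            ENNReal.ofReal_eq_coe_nnreal hρ.le]
          exact this.le
      _ = ENNReal.ofReal (β ^ q) := tsum_ofReal_kernel_mul hq hβ hκ
  · have huniv : ν univ = ∑' k : ℕ, (2 ^ q) ^ (k + 1) * ∑' j, (r k j : ℝ≥0∞) ^ δ := by
      rw [hν, Measure.sum_apply _ MeasurableSet.univ, ENNReal.tsum_prod']
      simp [hw, ENNReal.tsum_mul_left]
    calc 6 ^ δ * ν univ ≤ 6 ^ δ * ∑' k : ℕ, (2 ^ q) ^ (k + 1) *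
          (hContent n δ {x ∈ Ω | s * 2 ^ k < ‖fderiv ℝ u x‖} +
            ε' k / (6 ^ δ * (2 ^ q) ^ (k + 1))) := by
          rw [huniv]
          gcongr with k
          exact hsum k
      _ = 6 ^ δ * (∑' k : ℕ, (2 ^ q) ^ (k + 1) *
          hContent n δ {x ∈ Ω | s * 2 ^ k < ‖fderiv ℝ u x‖}) + ∑' k, ε' k := by
          simp_rw [mul_add, ENNReal.tsum_add, mul_add]
          congr 1
          rw [← ENNReal.tsum_mul_left]
          refine tsum_congr fun k => ?_
          rw [← mul_assoc, ENNReal.mul_div_cancel (hc0 k) (hcT k)]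
      _ ≤ _ := by gcongr

theorem lintegral_Ioi_comp_mul_left (f : ℝ → ℝ≥0∞) {c : ℝ} (hc : 0 < c) :
    ∫⁻ t in Ioi 0, f (c * t) = ENNReal.ofReal c⁻¹ * ∫⁻ t in Ioi 0, f t := by
  have hemb : MeasurableEmbedding fun t : ℝ => c * t :=
    (Homeomorph.mulLeft₀ c hc.ne').measurableEmbedding
  have hpre : (fun t : ℝ => c * t) ⁻¹' Ioi 0 = Ioi 0 := by
    ext t
    simp [hc]
  calc ∫⁻ t in Ioi 0, f (c * t) = ∫⁻ t, f t ∂((volume.map fun t => c * t).restrict (Ioi 0)) := by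
        rw [hemb.restrict_map, hemb.lintegral_map, hpre]
    _ = _ := by
        rw [Real.map_volume_mul_left hc.ne', Measure.restrict_smul, lintegral_smul_measure,
          abs_of_pos (inv_pos.2 hc), smul_eq_mul]

theorem measurable_hContent_level {n : ℕ} {δ : ℝ} (Ω : Set (EuclideanSpace ℝ (Fin n)))
    (f : EuclideanSpace ℝ (Fin n) → ℝ) :
    Measurable fun t : ℝ => hContent n δ {x ∈ Ω | t < f x} :=
  Antitone.measurable fun _ _ hst => hContent_mono fun _ hx => ⟨hx.1, hst.trans_lt hx.2⟩

/-- Integrating level-set estimates summed over dyadic levels gives a strong-type inequality. -/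
theorem choquet_rpow_le_of_level_le {n : ℕ} {δ : ℝ} {Ω : Set (EuclideanSpace ℝ (Fin n))}
    {f g : EuclideanSpace ℝ (Fin n) → ℝ} (hf : ∀ x, 0 ≤ f x) (hg : ∀ x, 0 ≤ g x)
    {p A : ℝ} (hp : 0 < p) (hA : 0 < A) {τ C Q : ℝ≥0∞}
    (h : ∀ s : ℝ, 0 < s → τ * hContent n δ {x ∈ Ω | A * s < f x} ≤
      C * ∑' k : ℕ, Q ^ (k + 1) * hContent n δ {x ∈ Ω | s * 2 ^ k < g x}) :
    τ * choquet n δ Ω (fun x => f x ^ p) ≤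
      C * (Q * (1 - Q * ENNReal.ofReal (2 ^ (-p)))⁻¹) * ENNReal.ofReal (A ^ p) *
        choquet n δ Ω fun x => g x ^ p := by
  have hlevel : ∀ {φ : EuclideanSpace ℝ (Fin n) → ℝ}, (∀ x, 0 ≤ φ x) → ∀ {a : ℝ}, 0 ≤ a →
      {x ∈ Ω | a ^ p < φ x ^ p} = {x ∈ Ω | a < φ x} := fun hφ a ha => by
    ext x
    simp only [mem_ofPred_eq, Real.rpow_lt_rpow_iff ha (hφ x) hp]
  have hscale : ∀ t : ℝ, 0 < t → ∀ k : ℕ, (t ^ p⁻¹ / A * 2 ^ k) ^ p = (2 ^ k / A) ^ p * t := by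
    intro t ht k
    rw [div_mul_eq_mul_div, mul_div_assoc, Real.mul_rpow (by positivity) (by positivity),
      Real.rpow_inv_rpow ht.le hp.ne', mul_comm]
  have hmeas : ∀ k : ℕ, Measurable fun t : ℝ =>
      hContent n δ {x ∈ Ω | (2 ^ k / A) ^ p * t < g x ^ p} := fun k =>
    (measurable_hContent_level Ω fun x => g x ^ p).comp (measurable_const_mul _)
  calc τ * choquet n δ Ω (fun x => f x ^ p)
      = ∫⁻ t in Ioi 0, τ * hContent n δ {x ∈ Ω | t < f x ^ p} := by
        rw [choquet, lintegral_const_mul _ (measurable_hContent_level Ω fun x => f x ^ p)]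
    _ ≤ ∫⁻ t in Ioi 0, C * ∑' k : ℕ, Q ^ (k + 1) *
          hContent n δ {x ∈ Ω | (2 ^ k / A) ^ p * t < g x ^ p} := by
        refine setLIntegral_mono' measurableSet_Ioi fun t ht => ?_
        have ht0 : 0 < t := ht
        have h1 := h (t ^ p⁻¹ / A) (by positivity)
        rw [mul_div_cancel₀ _ hA.ne', ← hlevel hf (by positivity),
          Real.rpow_inv_rpow ht0.le hp.ne'] at h1
        refine h1.trans_eq ?_
        congr 1
        refine tsum_congr fun k => ?_
        rw [← hlevel hg (by positivity), hscale t ht0]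
    _ = C * ∑' k : ℕ, Q ^ (k + 1) * (ENNReal.ofReal ((2 ^ k / A) ^ p)⁻¹ *
          choquet n δ Ω fun x => g x ^ p) := by
        rw [lintegral_const_mul _ (Measurable.tsum fun k => (hmeas k).const_mul _),
          lintegral_tsum fun k => ((hmeas k).const_mul _).aemeasurable]
        congr 1
        refine tsum_congr fun k => ?_
        rw [lintegral_const_mul _ (hmeas k), choquet, lintegral_Ioi_comp_mul_left
          (fun t => hContent n δ {x ∈ Ω | t < g x ^ p}) (by positivity)]
    _ = _ := by
        have hterm : ∀ k : ℕ, Q ^ (k + 1) * (ENNReal.ofReal ((2 ^ k / A) ^ p)⁻¹ *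
            choquet n δ Ω fun x => g x ^ p) =
            Q * (ENNReal.ofReal (A ^ p) * choquet n δ Ω fun x => g x ^ p) *
              (Q * ENNReal.ofReal (2 ^ (-p))) ^ k := by
          intro k
          have : ((2 ^ k / A) ^ p)⁻¹ = A ^ p * (2 ^ (-p)) ^ k := by
            rw [← Real.inv_rpow (by positivity), inv_div, Real.div_rpow hA.le (by positivity),
              Real.rpow_neg zero_le_two, inv_pow, ← Real.rpow_natCast, ← Real.rpow_natCast,
              ← Real.rpow_mul zero_le_two, ← Real.rpow_mul zero_le_two, mul_comm p]
            rfl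
          rw [this, ENNReal.ofReal_mul (by positivity), ENNReal.ofReal_pow (by positivity)]
          ring
        rw [tsum_congr hterm, ENNReal.tsum_mul_left, ENNReal.tsum_geometric]
        ring

/-- Theorem: `(p,p)`-Poincaré inequality in John domains w.r.t. the Hausdorff
content, with explicit dependence on the John constants. For `0 < δ ≤ n` and `p > δ/n` there is
`c = c(n, p, δ)` such that for every bounded `(α,β)`-John domain `Ω` and every `u ∈ C¹(Ω)`,
`inf_b ∫_Ω |u-b|^p dH^δ_∞ ≤ c β^p (β/α)^{2np} ∫_Ω |∇u|^p dH^δ_∞`. -/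
theorem poincare_john_content (n : ℕ) (hn : 2 ≤ n) (δ p : ℝ)
    (hδ0 : 0 < δ) (hδn : δ ≤ (n : ℝ)) (hp : δ / n < p) :
    ∃ c : ℝ≥0, 0 < c ∧
      ∀ α β : ℝ, 0 < α → α ≤ β →
        ∀ Ω : Set (EuclideanSpace ℝ (Fin n)), IsOpen Ω → IsConnected Ω → IsBounded Ω →
          IsJohnDomain n α β Ω →
          ∀ u : EuclideanSpace ℝ (Fin n) → ℝ, ContDiffOn ℝ 1 u Ω →
            ⨅ b : ℝ, choquet n δ Ω (fun x => |u x - b| ^ p)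
              ≤ c * ENNReal.ofReal (β ^ p * (β / α) ^ (2 * n * p)) *
                  choquet n δ Ω fun x => ‖fderiv ℝ u x‖ ^ p := by
  have hn0 : (0 : ℝ) < n := by exact_mod_cast (by lia : 0 < n)
  set q := δ / n with hq_def
  have hq : 0 < q := by positivity
  have hp0 : 0 < p := hq.trans hp
  have hθ : 0 < 1 - (2 : ℝ) ^ (-q) :=
    sub_pos.2 (Real.rpow_lt_one_of_one_lt_of_neg one_lt_two (by linarith))
  have hη : 0 < 1 - (2 : ℝ) ^ q * 2 ^ (-p) := by
    rw [← Real.rpow_add two_pos]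
    exact sub_pos.2 (Real.rpow_lt_one_of_one_lt_of_neg one_lt_two (by linarith))
  set K : ℝ := 6 ^ δ * (2 ^ q * (1 - 2 ^ q * 2 ^ (-p))⁻¹) with hK_def
  have hK : 0 < K := by positivity
  refine ⟨(K * 4 ^ p * 16 ^ δ / (1 - 2 ^ (-q))).toNNReal, Real.toNNReal_pos.2 (by positivity), ?_⟩
  intro α β hα hαβ Ω hΩ _ _ hJ u hu
  have hβ : 0 < β := hα.trans_le hαβ
  obtain ⟨b, hb⟩ := exists_mul_hContent_level_le hn hδ0 hδn hα hαβ hΩ hJ hu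
  rw [← hq_def] at hb
  refine (iInf_le _ b).trans ?_
  have hstrong := choquet_rpow_le_of_level_le (fun x => abs_nonneg (u x - b))
    (fun x => norm_nonneg (fderiv ℝ u x)) hp0 (by positivity : 0 < 4 * β) hb
  have hτ : 0 < (α / (2 * β) / 8) ^ δ * (1 - 2 ^ (-q)) := by positivity
  rw [← ENNReal.mul_le_mul_iff_right (ENNReal.ofReal_pos.2 hτ).ne' ENNReal.ofReal_ne_top]
  refine hstrong.trans ?_
  rw [← mul_assoc (ENNReal.ofReal _)]
  refine mul_le_mul_left ?_ _
  have hofReal : (6 : ℝ≥0∞) ^ δ * (2 ^ q * (1 - 2 ^ q * ENNReal.ofReal (2 ^ (-p)))⁻¹) =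
      ENNReal.ofReal K := by
    rw [hK_def, ENNReal.ofReal_mul (by positivity), ENNReal.ofReal_mul (by positivity),
      ENNReal.ofReal_inv_of_pos hη, ENNReal.ofReal_sub _ (by positivity),
      ENNReal.ofReal_mul (by positivity), ← ENNReal.ofReal_rpow_of_pos two_pos (p := q),
      ← ENNReal.ofReal_rpow_of_pos (by norm_num : (0 : ℝ) < 6), ENNReal.ofReal_ofNat,
      ENNReal.ofReal_ofNat, ENNReal.ofReal_one]
  have hexp : δ ≤ 2 * n * p := by
    have := (div_lt_iff₀ hn0).1 hp
    nlinarith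
  have hratio : 1 ≤ (α / β) ^ δ * (β / α) ^ (2 * n * p) := by
    rw [← inv_div β α, Real.inv_rpow (by positivity), ← Real.rpow_neg (by positivity),
      ← Real.rpow_add (by positivity)]
    exact Real.one_le_rpow ((one_le_div hα).2 hαβ) (by linarith)
  have hsplit : (α / (2 * β) / 8) ^ δ * 16 ^ δ = (α / β) ^ δ := by
    rw [← Real.mul_rpow (by positivity) (by positivity)]
    congr 1
    field_simp
    norm_num
  rw [hofReal, ← ENNReal.ofReal, ← ENNReal.ofReal_mul hK.le, ← ENNReal.ofReal_mul (by positivity),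
    ← ENNReal.ofReal_mul hτ.le]
  refine ENNReal.ofReal_le_ofReal ?_
  calc K * (4 * β) ^ p = K * 4 ^ p * β ^ p * 1 := by
        rw [Real.mul_rpow (by norm_num) hβ.le]
        ring
    _ ≤ K * 4 ^ p * β ^ p * ((α / β) ^ δ * (β / α) ^ (2 * n * p)) := by gcongr
    _ = _ := by
        rw [← hsplit]
        field_simp
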